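/- Let N ∈ {1,…,n}, and let I ⊆ {1,…,n} with 2 ≤ |I| ≤ n − 2 be such that both I and its complement {1,…,n}∖I contain a heavy index (so that v_I is a primitive generator of the tropical moduli fan). Then there exists a unique family of real numbers (c_S)_{S ∈ V_{N,w}} such that: (i) v_I − Σ_{S ∈ V_{N,w}} c_S v_S lies in the image of φ_w (i.e., v_I = Σ_S c_S v_S in the quotient ℝ^{P_w}/Im(φ_w)); (ii) c_S = 0 for every S ∈ V_{N,w} that violates the containment condition, namely S ⊆ {1,…,n}∖I when N ∈ I, and S ⊆ I when N ∉ I; (iii) c_S ≥ 0 for all S ∈ V_{N,w}; and (iv) c_S = 0 for at least one S ∈ V_{N,w}. -/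

import Mathlib

open Finset

/-- The heavy/light weight vector: weight `1` on the first `n - m` indices, `ε` on the rest. -/
def wt (n m : ℕ) (ε : ℚ) : Fin n → ℚ := fun i => if (i : ℕ) < n - m then 1 else ε

/-- `V_{N,w}`: the set of 2-element subsets `S ⊆ {1,…,n} ∖ {N}` such that both `S`
and its complement have total weight at least `1`. -/
def Vset (n m : ℕ) (ε : ℚ) (N : Fin n) : Finset (Finset (Fin n)) :=
  Finset.univ.filter (fun S => S.card = 2 ∧ N ∉ S ∧
    1 ≤ ∑ i ∈ S, wt n m ε i ∧ 1 ≤ ∑ i ∈ Sᶜ, wt n m ε i)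

/-- The index set `P_w` of coordinates: 2-element subsets `T` of `{1,…,n}` that are not
contained in the set of light indices, i.e. containing at least one heavy index. -/
def PwT (n m : ℕ) : Type := {T : Finset (Fin n) // T.card = 2 ∧ ∃ i ∈ T, (i : ℕ) < n - m}

/-- The linear map `φ_w : ℝⁿ → ℝ^{P_w}`, sending `a` to the vector whose coordinate at
`T = {t₁, t₂}` is `a_{t₁} + a_{t₂}`. -/
def phiW (n m : ℕ) : (Fin n → ℝ) →ₗ[ℝ] (PwT n m → ℝ) where
  toFun a := fun T => ∑ i ∈ T.val, a i
  map_add' a b := by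
    funext T
    exact Finset.sum_add_distrib
  map_smul' c a := by
    funext T
    simp [Finset.mul_sum]

/-- The vector `v_I ∈ ℝ^{P_w}` whose coordinate at `T` is `1` if `|I ∩ T| = 1`
and `0` otherwise. -/
def vI (n m : ℕ) (I : Finset (Fin n)) : PwT n m → ℝ :=
  fun T => if (I ∩ T.val).card = 1 then 1 else 0

/-- The indicator, on the coordinates `T`, of the condition `T ⊆ J`. -/
def subsetInd (n m : ℕ) (J : Finset (Fin n)) : PwT n m → ℝ :=
  fun T => if T.val ⊆ J then 1 else 0

/-- Extension by zero of a family indexed by `V_{N,w}` to all coordinates. -/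
def extendFamily (n m : ℕ) (ε : ℚ) (N : Fin n) (c : {S // S ∈ Vset n m ε N} → ℝ) :
    PwT n m → ℝ :=
  fun T => if h : T.val ∈ Vset n m ε N then c ⟨T.val, h⟩ else 0

theorem one_le_sum_wt_iff {n m : ℕ} {ε : ℚ} (hnm : m ≤ n) (hε0 : 0 < ε) (hε1 : ε < 1 / (m : ℚ))
    (S : Finset (Fin n)) : 1 ≤ ∑ i ∈ S, wt n m ε i ↔ ∃ i ∈ S, (i : ℕ) < n - m := by
  have hm : (0 : ℚ) < m := by
    rcases Nat.eq_zero_or_pos m with rfl | h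
    · simp at hε1
      linarith
    · exact_mod_cast h
  have hnonneg : ∀ i, 0 ≤ wt n m ε i := fun i => by
    unfold wt
    split_ifs <;> linarith
  constructor
  · intro h
    by_contra! hlight
    have hsum : ∑ i ∈ S, wt n m ε i = S.card * ε := by
      rw [← nsmul_eq_mul]
      exact Finset.sum_eq_card_nsmul fun i hi => if_neg (hlight i hi).not_gt
    have hcard : S.card ≤ m := by
      calc S.card = (S.map Fin.valEmbedding).card := (Finset.card_map _).symm
        _ ≤ (Finset.Ico (n - m) n).card := by
          refine Finset.card_le_card fun x hx => ?_
          obtain ⟨i, hi, rfl⟩ := Finset.mem_map.1 hx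
          exact Finset.mem_Ico.2 ⟨hlight i hi, i.isLt⟩
        _ = m := by
          rw [Nat.card_Ico]
          omega
    have hcard' : (S.card : ℚ) ≤ m := by exact_mod_cast hcard
    rw [lt_div_iff₀ hm] at hε1
    nlinarith
  · rintro ⟨i, hi, hlt⟩
    calc (1 : ℚ) = wt n m ε i := (if_pos hlt).symm
      _ ≤ _ := Finset.single_le_sum (fun j _ => hnonneg j) hi

theorem mem_Vset_iff {n m : ℕ} {ε : ℚ} (hnm : m ≤ n) (hε0 : 0 < ε) (hε1 : ε < 1 / (m : ℚ))
    (N : Fin n) (S : Finset (Fin n)) :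
    S ∈ Vset n m ε N ↔ S.card = 2 ∧ N ∉ S ∧
      (∃ i ∈ S, (i : ℕ) < n - m) ∧ ∃ i ∈ Sᶜ, (i : ℕ) < n - m := by
  simp only [Vset, Finset.mem_filter, Finset.mem_univ, true_and,
    one_le_sum_wt_iff hnm hε0 hε1]

theorem vI_compl (n m : ℕ) (I : Finset (Fin n)) : vI n m Iᶜ = vI n m I := by
  funext T
  have h : (I ∩ T.val).card + (Iᶜ ∩ T.val).card = 2 := by
    have h := Finset.card_inter_add_card_sdiff T.val I
    rwa [T.property.1, Finset.sdiff_eq_inter_compl, Finset.inter_comm, Finset.inter_comm _ Iᶜ] at h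
  unfold vI
  congr 1
  apply propext
  omega

theorem vI_eq_phiW_sub (n m : ℕ) (J : Finset (Fin n)) :
    vI n m J = phiW n m (fun i => if i ∈ J then 1 else 0) - (2 : ℝ) • subsetInd n m J := by
  funext T
  obtain ⟨T, hT, hheavy⟩ := T
  obtain ⟨a, b, hab, rfl⟩ := Finset.card_eq_two.1 hT
  change (if (J ∩ {a, b}).card = 1 then (1 : ℝ) else 0) =
    (∑ i ∈ {a, b}, if i ∈ J then (1 : ℝ) else 0) - 2 * (if {a, b} ⊆ J then 1 else 0)
  rw [Finset.sum_pair hab]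
  by_cases ha : a ∈ J <;> by_cases hb : b ∈ J <;>
    simp [Finset.insert_subset_iff, Finset.inter_insert_of_mem, Finset.inter_insert_of_notMem,
      Finset.inter_singleton_of_mem, Finset.inter_singleton_of_notMem, ha, hb, Finset.card_pair hab]
  norm_num

theorem sum_smul_subsetInd (n m : ℕ) (ε : ℚ) (N : Fin n) (c : {S // S ∈ Vset n m ε N} → ℝ) :
    ∑ S, c S • subsetInd n m (S : Finset (Fin n)) = extendFamily n m ε N c := by
  funext T
  have hiff : ∀ S : {S // S ∈ Vset n m ε N}, T.val ⊆ S.val ↔ T.val = S.val := fun S => by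
    have hS : S.val.card = 2 := (Finset.mem_filter.1 S.property).2.1
    exact ⟨fun h => Finset.eq_of_subset_of_card_le h (by rw [hS, T.property.1]),
      fun h => h.subset⟩
  simp only [Finset.sum_apply, Pi.smul_apply, subsetInd, hiff, smul_eq_mul, mul_ite, mul_one,
    mul_zero, extendFamily]
  split_ifs with h
  · rw [Finset.sum_eq_single ⟨T.val, h⟩]
    · simp
    · exact fun S _ hS => if_neg fun h' => hS (Subtype.ext h'.symm)
    · simp
  · exact Finset.sum_eq_zero fun S _ =>
      if_neg fun h' : T.val = S.val => h (by rw [h']; exact S.property)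

theorem sub_sum_mem_range_iff (n m : ℕ) (ε : ℚ) (N : Fin n) (J : Finset (Fin n))
    (c : {S // S ∈ Vset n m ε N} → ℝ) :
    vI n m J - ∑ S, c S • vI n m (S : Finset (Fin n)) ∈ LinearMap.range (phiW n m) ↔
      extendFamily n m ε N c - subsetInd n m J ∈ LinearMap.range (phiW n m) := by
  have hsum : ∑ S, c S • vI n m (S : Finset (Fin n)) =
      phiW n m (∑ S, c S • fun i => if i ∈ (S : Finset (Fin n)) then 1 else 0) -
        (2 : ℝ) • extendFamily n m ε N c := by
    rw [← sum_smul_subsetInd, map_sum, Finset.smul_sum, ← Finset.sum_sub_distrib]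
    refine Finset.sum_congr rfl fun S _ => ?_
    rw [vI_eq_phiW_sub, map_smul, smul_sub, smul_comm]
  rw [hsum, vI_eq_phiW_sub, sub_sub_sub_comm,
    ← map_sub, ← smul_sub, sub_eq_add_neg,
    Submodule.add_mem_iff_right _ (LinearMap.mem_range_self _ _), ← smul_neg, neg_sub,
    Submodule.smul_mem_iff _ (two_ne_zero (α := ℝ))]

theorem eq_zero_of_mem_range_of_support {n m : ℕ} {J : Finset (Fin n)}
    (hJ : ∃ i ∈ J, (i : ℕ) < n - m) (hJc : ∃ i ∈ Jᶜ, (i : ℕ) < n - m) (hcard : 2 ≤ Jᶜ.card)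
    {d : PwT n m → ℝ} (hd : d ∈ LinearMap.range (phiW n m))
    (hsupp : ∀ T : PwT n m, ¬ T.val ⊆ J → d T = 0) : d = 0 := by
  obtain ⟨a, rfl⟩ := hd
  obtain ⟨h, hhJ, hh⟩ := hJ
  obtain ⟨b, hbJ, hb⟩ := hJc
  obtain ⟨y, hyJ, hyb⟩ := Finset.exists_mem_ne hcard b
  rw [Finset.mem_compl] at hbJ hyJ
  have key : ∀ s t : Fin n, (s : ℕ) < n - m → s ≠ t → s ∉ J ∨ t ∉ J → a s + a t = 0 := by
    intro s t hs hst hout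
    have := hsupp ⟨{s, t}, Finset.card_pair hst, s, by simp, hs⟩ (by
      rw [Finset.insert_subset_iff, Finset.singleton_subset_iff]
      tauto)
    rwa [← Finset.sum_pair hst]
  have hbh := key b h hb (by rintro rfl; contradiction) (Or.inl hbJ)
  have hby := key b y hb hyb.symm (Or.inl hbJ)
  have hhy := key h y hh (by rintro rfl; contradiction) (Or.inr hyJ)
  suffices a = 0 by rw [this, map_zero]
  funext x
  by_cases hx : x ∈ J
  · have := key b x hb (by rintro rfl; contradiction) (Or.inl hbJ)
    simp only [Pi.zero_apply]
    linarith
  · have := key h x hh (by rintro rfl; contradiction) (Or.inr hx)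
    simp only [Pi.zero_apply]
    linarith

theorem exists_mem_Vset_not_subset {n m : ℕ} {ε : ℚ} (hnm : m ≤ n) (hε0 : 0 < ε)
    (hε1 : ε < 1 / (m : ℚ)) {N : Fin n} {J : Finset (Fin n)} (hN : N ∉ J)
    (hJ : ∃ i ∈ J, (i : ℕ) < n - m) (hJc : ∃ i ∈ Jᶜ, (i : ℕ) < n - m)
    (hcard : 2 ≤ J.card) (hcardc : 2 ≤ Jᶜ.card) : ∃ S ∈ Vset n m ε N, ¬ S ⊆ J := by
  obtain ⟨h, hhJ, hh⟩ := hJ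
  by_cases hNh : (N : ℕ) < n - m
  · obtain ⟨b, hbJ, hbN⟩ := Finset.exists_mem_ne hcardc N
    rw [Finset.mem_compl] at hbJ
    have hhb : h ≠ b := by rintro rfl; contradiction
    have hNh' : N ≠ h := by rintro rfl; contradiction
    have hNS : N ∉ ({h, b} : Finset (Fin n)) := by simp [hNh', hbN.symm]
    exact ⟨{h, b}, (mem_Vset_iff hnm hε0 hε1 _ _).2 ⟨Finset.card_pair hhb, hNS,
      ⟨h, by simp, hh⟩, N, Finset.mem_compl.2 hNS, hNh⟩, fun hS => hbJ (hS (by simp))⟩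
  · obtain ⟨b, hbJ, hb⟩ := hJc
    obtain ⟨x, hxJ, hxh⟩ := Finset.exists_mem_ne hcard h
    rw [Finset.mem_compl] at hbJ
    have hbx : b ≠ x := by rintro rfl; contradiction
    have hbh : h ≠ b := by rintro rfl; contradiction
    have hNb : N ≠ b := by rintro rfl; contradiction
    have hNx : N ≠ x := by rintro rfl; contradiction
    exact ⟨{b, x}, (mem_Vset_iff hnm hε0 hε1 _ _).2 ⟨Finset.card_pair hbx, by simp [hNb, hNx],
      ⟨b, by simp, hb⟩, h, by simp [hbh, hxh.symm], hh⟩, fun hS => hbJ (hS (by simp))⟩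

/-- Existence and uniqueness of the representation, with `J` the one of `I`, `Iᶜ` avoiding `N`. -/
theorem existsUnique_representation_of_notMem {n m : ℕ} {ε : ℚ} (hnm : m ≤ n) (hε0 : 0 < ε)
    (hε1 : ε < 1 / (m : ℚ)) {N : Fin n} {J : Finset (Fin n)} (hN : N ∉ J)
    (hJ : ∃ i ∈ J, (i : ℕ) < n - m) (hJc : ∃ i ∈ Jᶜ, (i : ℕ) < n - m)
    (hcard : 2 ≤ J.card) (hcardc : 2 ≤ Jᶜ.card) :
    ∃! c : {S // S ∈ Vset n m ε N} → ℝ,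
      (vI n m J - ∑ S, c S • vI n m (S : Finset (Fin n)) ∈ LinearMap.range (phiW n m)) ∧
      (∀ S, c S ≠ 0 → (S : Finset (Fin n)) ⊆ J) ∧ (∀ S, 0 ≤ c S) ∧ ∃ S, c S = 0 := by
  simp only [sub_sum_mem_range_iff]
  refine ⟨fun S => if S.val ⊆ J then 1 else 0, ⟨?_, ?_, ?_, ?_⟩, ?_⟩
  · convert zero_mem (LinearMap.range (phiW n m))
    rw [sub_eq_zero]
    funext T
    by_cases hT : T.val ⊆ J
    · obtain ⟨i, hi, hi'⟩ := hJc
      have hV : T.val ∈ Vset n m ε N := (mem_Vset_iff hnm hε0 hε1 _ _).2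
        ⟨T.property.1, fun h => hN (hT h), T.property.2, i,
          Finset.compl_subset_compl.2 hT hi, hi'⟩
      simp [extendFamily, subsetInd, hT, hV]
    · simp [extendFamily, subsetInd, hT]
  · intro S hS
    by_contra h
    exact hS (if_neg h)
  · intro S
    dsimp only
    split_ifs <;> norm_num
  · obtain ⟨S, hS, hSJ⟩ := exists_mem_Vset_not_subset hnm hε0 hε1 hN hJ hJc hcard hcardc
    exact ⟨⟨S, hS⟩, if_neg hSJ⟩
  · rintro c ⟨hrange, hsupp, -, -⟩
    have hzero := eq_zero_of_mem_range_of_support hJ hJc hcardc hrange fun T hT => by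
      have : extendFamily n m ε N c T = 0 := by
        unfold extendFamily
        split_ifs with h
        · by_contra hne
          exact hT (hsupp _ hne)
        · rfl
      simp [this, subsetInd, hT]
    funext S
    obtain ⟨hS2, -, hSheavy, -⟩ := (mem_Vset_iff hnm hε0 hε1 N S.val).1 S.property
    have hS := congrFun (sub_eq_zero.1 hzero) ⟨S.val, hS2, hSheavy⟩
    simpa [extendFamily, subsetInd] using hS

/-- Definition/Lemma `def:positive-rep`: existence and uniqueness of the
positive representation: for `N ∈ {1,…,n}` and `I ⊆ {1,…,n}` with `2 ≤ |I| ≤ n − 2` such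
that both `I` and its complement contain a heavy index, there is a unique family of reals
`(c_S)_{S ∈ V_{N,w}}` such that (i) `v_I = ∑_S c_S v_S` modulo `Im(φ_w)`; (ii) `c_S = 0`
unless `S ⊆ Iᶜ` when `N ∈ I`, resp. `S ⊆ I` when `N ∉ I`; (iii) all `c_S ≥ 0`; and
(iv) some `c_S = 0`. -/
theorem positive_representation_exists_unique
    (n m : ℕ) (ε : ℚ) (hn : 4 ≤ n) (hnm : m + 2 ≤ n) (hε0 : 0 < ε) (hε1 : ε < 1 / (m : ℚ))
    (N : Fin n) (I : Finset (Fin n)) (hI2 : 2 ≤ I.card) (hIn : I.card ≤ n - 2)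
    (hIheavy : ∃ i ∈ I, (i : ℕ) < n - m) (hIcheavy : ∃ i ∈ Iᶜ, (i : ℕ) < n - m) :
    ∃! c : {S // S ∈ Vset n m ε N} → ℝ,
      ((vI n m I - ∑ S : {S // S ∈ Vset n m ε N}, c S • vI n m (S : Finset (Fin n)))
          ∈ LinearMap.range (phiW n m)) ∧
      (∀ S : {S // S ∈ Vset n m ε N}, c S ≠ 0 →
          ((N ∈ I ∧ (S : Finset (Fin n)) ⊆ Iᶜ) ∨ (N ∉ I ∧ (S : Finset (Fin n)) ⊆ I))) ∧
      (∀ S, 0 ≤ c S) ∧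
      (∃ S, c S = 0) := by
  have hcompl : I.card + Iᶜ.card = n := by
    rw [Finset.card_add_card_compl, Fintype.card_fin]
  by_cases hN : N ∈ I
  · simp only [hN, true_and, not_true_eq_false, false_and, or_false]
    rw [← vI_compl]
    exact existsUnique_representation_of_notMem (by omega) hε0 hε1 (by simpa using hN) hIcheavy
      (by simpa using hIheavy) (by omega) (by rw [compl_compl]; omega)
  · simp only [hN, false_and, not_false_eq_true, true_and, false_or]
    exact existsUnique_representation_of_notMem (by omega) hε0 hε1 hN hIheavy hIcheavy hI2
      (by omega)
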